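/- Let ℱ be a set of fact bases, F ∈ ℱ, R a disjunctive rule, (R, h) a trigger on F, and let ℱ_1 = (ℱ ∖ {F}) ∪ α_∨(F, R, h). If ℱ_1 ⊨ 𝒬 for a UCQ 𝒬, then either ℱ ⊨ 𝒬 or there exists a disjunctive piece-unifier μ_∨ of 𝒬 with R such that ℱ ⊨ {β_∨(𝒬, R, μ_∨)} ∪ 𝒬. -/

import Mathlib

/-! ## Basic syntax: terms, atoms, substitutions -/

/-- A term over variables `V` and constants `C`. -/
inductive FOTerm (V C : Type) where
  | var (v : V)
  | const (c : C)
deriving DecidableEq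

/-- An atom `p(t_1,...,t_n)`. -/
structure FOAtom (P V C : Type) where
  pred : P
  args : List (FOTerm V C)
deriving DecidableEq

/-- A substitution of variables by terms. -/
abbrev FOSubst (V C : Type) := V → FOTerm V C

variable {P V C : Type}

def FOTerm.applySub (u : FOSubst V C) : FOTerm V C → FOTerm V C
  | FOTerm.var v => u v
  | FOTerm.const c => FOTerm.const c

def FOAtom.applySub (u : FOSubst V C) (a : FOAtom P V C) : FOAtom P V C :=
  ⟨a.pred, a.args.map (FOTerm.applySub u)⟩

def applySubFS [DecidableEq P] [DecidableEq V] [DecidableEq C]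
    (u : FOSubst V C) (S : Finset (FOAtom P V C)) : Finset (FOAtom P V C) :=
  S.image (FOAtom.applySub u)

def FOTerm.varsOf [DecidableEq V] : FOTerm V C → Finset V
  | FOTerm.var v => {v}
  | FOTerm.const _ => ∅

def FOAtom.varsOf [DecidableEq V] (a : FOAtom P V C) : Finset V :=
  a.args.foldr (fun t acc => t.varsOf ∪ acc) ∅

/-- Variables occurring in a finite set of atoms. -/
def varsFS [DecidableEq V] (S : Finset (FOAtom P V C)) : Finset V :=
  S.sup FOAtom.varsOf

/-- Terms occurring in a finite set of atoms. -/
def termsFS [DecidableEq V] [DecidableEq C] (S : Finset (FOAtom P V C)) :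
    Finset (FOTerm V C) :=
  S.sup (fun a => a.args.toFinset)

/-- `h` is a homomorphism from the atom set `S₁` to the atom set `S₂`. -/
def IsHom (h : FOSubst V C) (S₁ S₂ : Finset (FOAtom P V C)) : Prop :=
  ∀ a ∈ S₁, a.applySub h ∈ S₂

/-- `S₂ ⊨ S₁` for atom sets viewed as existentially closed conjunctions:
there is a homomorphism from `S₁` to `S₂`. -/
def EntailsFS (S₂ S₁ : Finset (FOAtom P V C)) : Prop :=
  ∃ h : FOSubst V C, IsHom h S₁ S₂

/-! ## Disjunctive existential rules, triggers, chase step α -/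

/-- A disjunctive existential rule `B → H₁ ∨ ... ∨ Hₙ`. -/
structure DisjRule (P V C : Type) where
  body : Finset (FOAtom P V C)
  heads : List (Finset (FOAtom P V C))

/-- Well-formedness: non-empty body, at least one head disjunct, non-empty disjuncts. -/
def DisjRule.WF (R : DisjRule P V C) : Prop :=
  R.body.Nonempty ∧ R.heads ≠ [] ∧ ∀ H ∈ R.heads, H.Nonempty

/-- All variables of a rule. -/
def DisjRule.vars [DecidableEq V] (R : DisjRule P V C) : Finset V :=
  varsFS R.body ∪ R.heads.foldr (fun H acc => varsFS H ∪ acc) ∅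

/-- A trigger `(R, h)` on `F`: `h` is a homomorphism from the body of `R` to `F`. -/
def IsTrigger (R : DisjRule P V C) (h : FOSubst V C) (F : Finset (FOAtom P V C)) : Prop :=
  IsHom h R.body F

/-- `h'` is a safe extension of `h` for the head disjunct `H` of rule `R` w.r.t. the
fact base `F`: it agrees with `h` outside the existential variables of `H` and renames
the existential variables of `H` injectively to fresh variables. -/
def IsSafeExt [DecidableEq V] (F : Finset (FOAtom P V C)) (R : DisjRule P V C)
    (H : Finset (FOAtom P V C)) (h h' : FOSubst V C) : Prop :=
  (∀ v : V, v ∉ varsFS H \ varsFS R.body → h' v = h v) ∧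
  (∀ v ∈ varsFS H \ varsFS R.body, ∃ w : V, h' v = FOTerm.var w ∧ w ∉ varsFS F) ∧
  (∀ v ∈ varsFS H \ varsFS R.body, ∀ v' ∈ varsFS H \ varsFS R.body,
      h' v = h' v' → v = v')

/-- `L` is a result of the application `α_∨(F, R, h)` of the trigger `(R, h)` on `F`:
its `i`-th element is `F ∪ h^{safeᵢ}(Hᵢ)`. -/
def IsAlpha [DecidableEq P] [DecidableEq V] [DecidableEq C]
    (F : Finset (FOAtom P V C)) (R : DisjRule P V C) (h : FOSubst V C)
    (L : List (Finset (FOAtom P V C))) : Prop :=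
  L.length = R.heads.length ∧
  ∀ (i : ℕ) (hi : i < L.length) (hi' : i < R.heads.length),
    ∃ h' : FOSubst V C, IsSafeExt F R (R.heads.get ⟨i, hi'⟩) h h' ∧
      L.get ⟨i, hi⟩ = F ∪ applySubFS h' (R.heads.get ⟨i, hi'⟩)

/-! ## Partitions of terms (as equivalence relations), piece-unifiers -/

/-- A relation on terms, representing a partition of a set of terms (two terms are
related iff they belong to the same class). -/
abbrev TRel (V C : Type) := FOTerm V C → FOTerm V C → Prop

/-- Admissibility of a partition: no class contains two distinct constants. -/
def RelAdmissible (r : TRel V C) : Prop :=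
  ∀ c c' : C, r (FOTerm.const c) (FOTerm.const c') → c = c'

/-- `u` is a substitution associated with the partition represented by `r`:
it is constant on classes, maps each term to a member of its class (the selected term),
and gives priority to constants. -/
def IsAssocSub (r : TRel V C) (u : FOSubst V C) : Prop :=
  (∀ s t, r s t → s.applySub u = t.applySub u) ∧
  (∀ t, r t (t.applySub u)) ∧
  (∀ (v : V) (c : C), r (FOTerm.var v) (FOTerm.const c) → u v = FOTerm.const c)

/-- The data of a piece-unifier `(Q', H', P_u)`. -/
structure PieceUnif (P V C : Type) where
  Q' : Finset (FOAtom P V C)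
  H' : Finset (FOAtom P V C)
  rel : TRel V C

/-- `μ` is a piece-unifier of the CQ `Q` with the conjunctive rule `B → H`. -/
def IsPieceUnifier [DecidableEq P] [DecidableEq V] [DecidableEq C]
    (Q : Finset (FOAtom P V C)) (B H : Finset (FOAtom P V C))
    (μ : PieceUnif P V C) : Prop :=
  μ.Q'.Nonempty ∧ μ.Q' ⊆ Q ∧ μ.H' ⊆ H ∧
  Equivalence μ.rel ∧
  -- the partition is on the terms of Q' and H' (all other classes are singletons)
  (∀ s t, μ.rel s t → s = t ∨
      (s ∈ termsFS μ.Q' ∪ termsFS μ.H' ∧ t ∈ termsFS μ.Q' ∪ termsFS μ.H')) ∧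
  RelAdmissible μ.rel ∧
  -- classes containing an existential variable of H' contain otherwise only
  -- non-separating variables of Q'
  (∀ z ∈ varsFS μ.H' \ varsFS B, ∀ t, μ.rel (FOTerm.var z) t → t = FOTerm.var z ∨
      ∃ v : V, t = FOTerm.var v ∧ FOTerm.var v ∈ termsFS μ.Q' ∧ v ∉ varsFS (Q \ μ.Q')) ∧
  -- unification condition
  (∀ u : FOSubst V C, IsAssocSub μ.rel u → applySubFS u μ.Q' = applySubFS u μ.H')

/-- The join of a list of partitions (represented as relations): the equivalence
relation generated by their union. -/
def joinRel (rs : List (TRel V C)) : TRel V C :=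
  Relation.EqvGen (fun s t => ∃ r ∈ rs, r s t)

/-- The data of a disjunctive piece-unifier: the safe copies `Q₁, ..., Qₙ` together
with the conjunctive piece-unifiers `μ₁, ..., μₙ`. -/
structure DisjPieceUnif (P V C : Type) where
  Qs : List (Finset (FOAtom P V C))
  mus : List (PieceUnif P V C)

/-- The join of the partitions of a disjunctive piece-unifier. -/
def DisjPieceUnif.rel (μ : DisjPieceUnif P V C) : TRel V C :=
  joinRel (μ.mus.map PieceUnif.rel)

/-- `Qc` is a safe copy of `Q` (bijective renaming of its variables). -/
def IsSafeCopy [DecidableEq P] [DecidableEq V] [DecidableEq C]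
    (Q Qc : Finset (FOAtom P V C)) : Prop :=
  ∃ ρ : V → V, Function.Injective ρ ∧
    Qc = Q.image (FOAtom.applySub (fun v => FOTerm.var (ρ v)))

/-- `μ` is a disjunctive piece-unifier of the UCQ `𝒬` with the disjunctive rule `R`. -/
def IsDisjPieceUnifier [DecidableEq P] [DecidableEq V] [DecidableEq C]
    (𝒬 : Set (Finset (FOAtom P V C))) (R : DisjRule P V C)
    (μ : DisjPieceUnif P V C) : Prop :=
  μ.Qs.length = R.heads.length ∧ μ.mus.length = R.heads.length ∧
  -- each Qᵢ is a safe copy of a CQ of 𝒬, with variables disjoint from the rule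
  -- and from the other copies
  (∀ (i : ℕ) (hi : i < μ.Qs.length), ∃ Q ∈ 𝒬, IsSafeCopy Q (μ.Qs.get ⟨i, hi⟩)) ∧
  (∀ (i : ℕ) (hi : i < μ.Qs.length), Disjoint (varsFS (μ.Qs.get ⟨i, hi⟩)) R.vars) ∧
  (∀ (i j : ℕ) (hi : i < μ.Qs.length) (hj : j < μ.Qs.length), i ≠ j →
      Disjoint (varsFS (μ.Qs.get ⟨i, hi⟩)) (varsFS (μ.Qs.get ⟨j, hj⟩))) ∧
  -- each μᵢ is a piece-unifier of Qᵢ with B → Hᵢ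
  (∀ (i : ℕ) (hi : i < R.heads.length) (hi1 : i < μ.Qs.length) (hi2 : i < μ.mus.length),
      IsPieceUnifier (μ.Qs.get ⟨i, hi1⟩) R.body (R.heads.get ⟨i, hi⟩)
        (μ.mus.get ⟨i, hi2⟩)) ∧
  -- the join of the partitions is admissible
  RelAdmissible μ.rel

/-- `β_∨(𝒬, R, μ) = u(B) ∪ ⋃ᵢ u(Qᵢ ∖ Qᵢ')`, for `u` a substitution associated with
the join of the partitions of `μ`. -/
def betaRw [DecidableEq P] [DecidableEq V] [DecidableEq C]
    (R : DisjRule P V C) (μ : DisjPieceUnif P V C) (u : FOSubst V C) :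
    Finset (FOAtom P V C) :=
  applySubFS u R.body ∪
    (List.zipWith (fun Qi m => applySubFS u (Qi \ PieceUnif.Q' m)) μ.Qs μ.mus).foldr
      (· ∪ ·) ∅

/-! ## Semantics -/

/-- A first-order interpretation (with non-empty domain). -/
structure Interp (P V C : Type) where
  dom : Type
  nonempty : Nonempty dom
  rel : P → List dom → Prop
  cst : C → dom

def Interp.evalT (I : Interp P V C) (a : V → I.dom) : FOTerm V C → I.dom
  | FOTerm.var v => a v
  | FOTerm.const c => I.cst c

def Interp.satAtom (I : Interp P V C) (a : V → I.dom) (atm : FOAtom P V C) : Prop :=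
  I.rel atm.pred (atm.args.map (I.evalT a))

def Interp.satFS (I : Interp P V C) (a : V → I.dom) (S : Finset (FOAtom P V C)) : Prop :=
  ∀ atm ∈ S, I.satAtom a atm

/-- `I` is a model of the atom set `S` viewed as an existentially closed conjunction. -/
def Interp.modelsFB [DecidableEq V] (I : Interp P V C) (S : Finset (FOAtom P V C)) : Prop :=
  ∃ a : V → I.dom, I.satFS a S

/-- `I` satisfies the disjunctive existential rule `R`. -/
def Interp.satRule [DecidableEq V] (I : Interp P V C) (R : DisjRule P V C) : Prop :=
  ∀ a : V → I.dom, I.satFS a R.body →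
    ∃ H ∈ R.heads, ∃ a' : V → I.dom,
      (∀ v ∈ varsFS R.body, a' v = a v) ∧ I.satFS a' H

/-- First-order entailment `F, ℛ ⊨ 𝒬` of a UCQ from a fact base and a set of
disjunctive existential rules. -/
def SemEntails [DecidableEq V] (F : Finset (FOAtom P V C)) (ℛ : Set (DisjRule P V C))
    (𝒬 : Set (Finset (FOAtom P V C))) : Prop :=
  ∀ I : Interp P V C, I.modelsFB F → (∀ R ∈ ℛ, I.satRule R) →
    ∃ Q ∈ 𝒬, I.modelsFB Q

/-! ## Piece-rewriting -/

/-- `IsPieceRewriting ℛ 𝒬 𝒬'` holds when the UCQ `𝒬'` is obtained from the UCQ `𝒬`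
by a finite sequence of one-step piece-rewritings with rules of `ℛ`. -/
inductive IsPieceRewriting [DecidableEq P] [DecidableEq V] [DecidableEq C]
    (ℛ : Set (DisjRule P V C)) :
    Finset (Finset (FOAtom P V C)) → Finset (Finset (FOAtom P V C)) → Prop
  | refl (𝒬 : Finset (Finset (FOAtom P V C))) : IsPieceRewriting ℛ 𝒬 𝒬
  | step (𝒬 𝒬' : Finset (Finset (FOAtom P V C))) (R : DisjRule P V C)
      (μ : DisjPieceUnif P V C) (u : FOSubst V C) :
      IsPieceRewriting ℛ 𝒬 𝒬' → R ∈ ℛ →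
      IsDisjPieceUnifier (↑𝒬' : Set (Finset (FOAtom P V C))) R μ →
      IsAssocSub μ.rel u →
      IsPieceRewriting ℛ 𝒬 (insert (betaRw R μ u) 𝒬')

lemma FOAtom.mem_varsOf [DecidableEq V] {a : FOAtom P V C} {v : V} :
    v ∈ a.varsOf ↔ FOTerm.var v ∈ a.args := by
  obtain ⟨p, l⟩ := a
  simp only [FOAtom.varsOf]
  induction l with
  | nil => simp
  | cons t l ih =>
    rw [List.foldr_cons, Finset.mem_union, ih]
    cases t <;> simp [FOTerm.varsOf]

lemma mem_varsFS [DecidableEq V] {S : Finset (FOAtom P V C)} {v : V} :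
    v ∈ varsFS S ↔ ∃ a ∈ S, FOTerm.var v ∈ a.args := by
  simp [varsFS, Finset.mem_sup, FOAtom.mem_varsOf]

lemma varsFS_mono [DecidableEq V] {S T : Finset (FOAtom P V C)} (hST : S ⊆ T) :
    varsFS S ⊆ varsFS T :=
  Finset.sup_mono hST

lemma mem_termsFS [DecidableEq V] [DecidableEq C] {S : Finset (FOAtom P V C)}
    {t : FOTerm V C} : t ∈ termsFS S ↔ ∃ a ∈ S, t ∈ a.args := by
  simp [termsFS, Finset.mem_sup]

lemma FOTerm.applySub_applySub (u w : FOSubst V C) (t : FOTerm V C) :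
    (t.applySub u).applySub w = t.applySub (fun v => (u v).applySub w) := by
  cases t <;> rfl

lemma FOAtom.applySub_applySub (u w : FOSubst V C) (a : FOAtom P V C) :
    (a.applySub u).applySub w = a.applySub (fun v => (u v).applySub w) := by
  simp [FOAtom.applySub, FOTerm.applySub_applySub]

lemma FOAtom.applySub_congr {u w : FOSubst V C} {a : FOAtom P V C}
    (H : ∀ t ∈ a.args, t.applySub u = t.applySub w) : a.applySub u = a.applySub w := by
  simpa [FOAtom.applySub] using H

lemma FOAtom.applySub_congr_var {u w : FOSubst V C} {a : FOAtom P V C}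
    (H : ∀ v, FOTerm.var v ∈ a.args → u v = w v) : a.applySub u = a.applySub w := by
  refine FOAtom.applySub_congr fun t ht => ?_
  cases t with
  | var v => exact H v ht
  | const c => rfl

/-- Two atoms identified by `φ` are identified by any substitution that identifies
the arguments which `φ` identifies. -/
lemma FOAtom.applySub_eq_of_imp {φ u : FOSubst V C} {a b : FOAtom P V C}
    (hab : a.applySub φ = b.applySub φ)
    (H : ∀ s ∈ a.args, ∀ t ∈ b.args, s.applySub φ = t.applySub φ →
      s.applySub u = t.applySub u) : a.applySub u = b.applySub u := by
  obtain ⟨p, l⟩ := a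
  obtain ⟨q, m⟩ := b
  simp only [FOAtom.applySub, FOAtom.mk.injEq] at hab H ⊢
  refine ⟨hab.1, ?_⟩
  have hl : l.map (FOTerm.applySub φ) = m.map (FOTerm.applySub φ) := hab.2
  clear hab
  induction l generalizing m with
  | nil => cases m <;> simp_all
  | cons s l ih =>
    cases m with
    | nil => simp at hl
    | cons t m =>
      simp only [List.map_cons, List.cons.injEq] at hl ⊢
      exact ⟨H s (by simp) t (by simp) hl.1,
        ih m (fun s hs t ht => H s (by simp [hs]) t (by simp [ht])) hl.2⟩

/-- A homomorphic image of a variable is a constant or a variable of the target. -/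
lemma IsHom.mem_varsFS [DecidableEq V] {φ : FOSubst V C} {S T : Finset (FOAtom P V C)}
    (hφ : IsHom φ S T) {v w : V} (hv : v ∈ varsFS S) (hw : φ v = FOTerm.var w) :
    w ∈ varsFS T := by
  obtain ⟨a, ha, hva⟩ := _root_.mem_varsFS.1 hv
  exact _root_.mem_varsFS.2 ⟨_, hφ a ha, List.mem_map.2 ⟨_, hva, hw⟩⟩

lemma varsFS_body_subset [DecidableEq V] (R : DisjRule P V C) :
    varsFS R.body ⊆ R.vars :=
  Finset.subset_union_left

lemma varsFS_head_subset [DecidableEq V] (R : DisjRule P V C) {H : Finset (FOAtom P V C)}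
    (hH : H ∈ R.heads) : varsFS H ⊆ R.vars := by
  refine Finset.Subset.trans ?_ Finset.subset_union_right
  generalize R.heads = l at hH
  induction l with
  | nil => simp at hH
  | cons K l ih =>
    rcases List.mem_cons.1 hH with rfl | hK
    · exact Finset.subset_union_left
    · exact (ih hK).trans Finset.subset_union_right

lemma mem_foldr_union {α : Type} [DecidableEq α] {l : List (Finset α)} {a : α} :
    a ∈ l.foldr (· ∪ ·) ∅ ↔ ∃ s ∈ l, a ∈ s := by
  induction l with
  | nil => simp
  | cons s l ih => simp [ih]

/-- An admissible equivalence relation has an associated substitution. -/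
lemma exists_isAssocSub {r : TRel V C} (hr : Equivalence r) (hadm : RelAdmissible r) :
    ∃ u : FOSubst V C, IsAssocSub r u := by
  classical
  let S : Setoid (FOTerm V C) := ⟨r, hr⟩
  let rep : FOTerm V C → FOTerm V C := fun t =>
    if hc : ∃ c, r t (FOTerm.const c) then FOTerm.const hc.choose
    else (Quotient.mk S t).out
  have rep_const : ∀ t c, r t (FOTerm.const c) → rep t = FOTerm.const c := by
    intro t c htc
    have hc : ∃ c, r t (FOTerm.const c) := ⟨c, htc⟩
    simp only [rep, dif_pos hc]
    rw [hadm _ _ (hr.trans (hr.symm hc.choose_spec) htc)]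
  have rep_rel : ∀ t, r t (rep t) := by
    intro t
    by_cases hc : ∃ c, r t (FOTerm.const c)
    · obtain ⟨c, hc⟩ := hc
      rw [rep_const t c hc]
      exact hc
    · simp only [rep, dif_neg hc]
      exact hr.symm (Quotient.mk_out (s := S) t)
  have rep_congr : ∀ s t, r s t → rep s = rep t := by
    intro s t hst
    by_cases hc : ∃ c, r t (FOTerm.const c)
    · obtain ⟨c, hc⟩ := hc
      rw [rep_const t c hc, rep_const s c (hr.trans hst hc)]
    · have hc' : ¬ ∃ c, r s (FOTerm.const c) := fun ⟨c, hs⟩ =>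
        hc ⟨c, hr.trans (hr.symm hst) hs⟩
      simp only [rep, dif_neg hc, dif_neg hc']
      rw [Quotient.sound (s := S) hst]
  have happ : ∀ t : FOTerm V C, t.applySub (fun v => rep (FOTerm.var v)) = rep t := by
    intro t
    cases t with
    | var v => rfl
    | const c => exact (rep_const _ c (hr.refl _)).symm
  refine ⟨fun v => rep (FOTerm.var v), ?_, ?_, fun v c hvc => rep_const _ c hvc⟩
  · intro s t hst
    rw [happ, happ, rep_congr s t hst]
  · intro t
    rw [happ]
    exact rep_rel t

/-- A substitution that identifies related terms of each `r ∈ rs` identifies related terms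
of the join. -/
lemma joinRel_applySub {rs : List (TRel V C)} {ψ : FOSubst V C}
    (hψ : ∀ r ∈ rs, ∀ s t, r s t → s.applySub ψ = t.applySub ψ) {s t : FOTerm V C}
    (hst : joinRel rs s t) : s.applySub ψ = t.applySub ψ := by
  induction hst with
  | rel s t hst => obtain ⟨r, hr, hrst⟩ := hst; exact hψ r hr s t hrst
  | refl s => rfl
  | symm s t _ ih => exact ih.symm
  | trans s t w _ _ ih₁ ih₂ => exact ih₁.trans ih₂

section PieceOfHom

variable [DecidableEq P] [DecidableEq V] [DecidableEq C]

/-- The atoms of `Q` that `φ` does not map into `F`. -/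
def queryPiece (F Q : Finset (FOAtom P V C)) (φ : FOSubst V C) : Finset (FOAtom P V C) :=
  Q.filter fun a => a.applySub φ ∉ F

/-- The atoms of `H` having the same image by `φ` as some atom of `queryPiece F Q φ`. -/
def headPiece (F Q H : Finset (FOAtom P V C)) (φ : FOSubst V C) : Finset (FOAtom P V C) :=
  H.filter fun b => b.applySub φ ∈ applySubFS φ (queryPiece F Q φ)

/-- The piece-unifier induced by a substitution `φ` mapping `Q` into `F ∪ φ(H)`. -/
def pieceOfHom (F Q H : Finset (FOAtom P V C)) (φ : FOSubst V C) : PieceUnif P V C where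
  Q' := queryPiece F Q φ
  H' := headPiece F Q H φ
  rel s t := s = t ∨
    (s ∈ termsFS (queryPiece F Q φ) ∪ termsFS (headPiece F Q H φ) ∧
      t ∈ termsFS (queryPiece F Q φ) ∪ termsFS (headPiece F Q H φ) ∧
      s.applySub φ = t.applySub φ)

lemma applySub_eq_of_pieceOfHom_rel {F Q H : Finset (FOAtom P V C)} {φ : FOSubst V C}
    {s t : FOTerm V C} (hst : (pieceOfHom F Q H φ).rel s t) :
    s.applySub φ = t.applySub φ := by
  rcases hst with rfl | ⟨-, -, hst⟩
  · rfl
  · exact hst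

lemma isPieceUnifier_pieceOfHom {F Q B H : Finset (FOAtom P V C)} {φ : FOSubst V C}
    (hB : IsHom φ B F) (hQ : IsHom φ Q (F ∪ applySubFS φ H)) (hQF : ¬ IsHom φ Q F)
    (hfresh : ∀ z ∈ varsFS H \ varsFS B, ∃ w : V, φ z = FOTerm.var w ∧ w ∉ varsFS F)
    (hinj : ∀ z ∈ varsFS H \ varsFS B, ∀ z' ∈ varsFS H \ varsFS B, φ z = φ z' → z = z') :
    IsPieceUnifier Q B H (pieceOfHom F Q H φ) := by
  have hHsub : headPiece F Q H φ ⊆ H := Finset.filter_subset _ _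
  refine ⟨?_, Finset.filter_subset _ _, hHsub, ?_, ?_, ?_, ?_, ?_⟩
  · simp only [IsHom, not_forall] at hQF
    obtain ⟨a, ha, haF⟩ := hQF
    exact ⟨a, Finset.mem_filter.2 ⟨ha, haF⟩⟩
  · refine ⟨fun s => Or.inl rfl, ?_, ?_⟩
    · rintro s t (rfl | ⟨hs, ht, hst⟩)
      · exact Or.inl rfl
      · exact Or.inr ⟨ht, hs, hst.symm⟩
    · rintro s t w (rfl | ⟨hs, ht, hst⟩) (rfl | ⟨ht', hw, htw⟩)
      · exact Or.inl rfl
      · exact Or.inr ⟨ht', hw, htw⟩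
      · exact Or.inr ⟨hs, ht, hst⟩
      · exact Or.inr ⟨hs, hw, hst.trans htw⟩
  · rintro s t (rfl | ⟨hs, ht, -⟩)
    · exact Or.inl rfl
    · exact Or.inr ⟨hs, ht⟩
  · intro c c' hcc
    simpa [FOTerm.applySub] using applySub_eq_of_pieceOfHom_rel hcc
  · intro z hz t hzt
    have hz' : z ∈ varsFS H \ varsFS B := by
      rw [Finset.mem_sdiff] at hz ⊢
      exact ⟨varsFS_mono hHsub hz.1, hz.2⟩
    obtain ⟨w, hw, hwF⟩ := hfresh z hz'
    rcases hzt with rfl | ⟨-, ht, hzt⟩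
    · exact Or.inl rfl
    change φ z = _ at hzt
    rw [hw] at hzt
    cases t with
    | const c => exact absurd hzt (by simp [FOTerm.applySub])
    | var v =>
      change _ = φ v at hzt
      rcases Finset.mem_union.1 ht with ht | ht
      · refine Or.inr ⟨v, rfl, ht, fun hv => hwF ?_⟩
        refine IsHom.mem_varsFS (S := Q \ queryPiece F Q φ) (φ := φ) ?_ hv hzt.symm
        intro a ha
        by_contra haF
        rw [Finset.mem_sdiff] at ha
        exact ha.2 (Finset.mem_filter.2 ⟨ha.1, haF⟩)
      · left
        obtain ⟨a, ha, hva⟩ := mem_termsFS.1 ht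
        have hvB : v ∉ varsFS B := fun hv => hwF (hB.mem_varsFS hv hzt.symm)
        have hv : v ∈ varsFS H \ varsFS B :=
          Finset.mem_sdiff.2 ⟨mem_varsFS.2 ⟨a, hHsub ha, hva⟩, hvB⟩
        rw [hinj z hz' v hv (hw.trans hzt)]
  · intro u hu
    have key : ∀ a ∈ queryPiece F Q φ, ∀ b ∈ headPiece F Q H φ,
        a.applySub φ = b.applySub φ → a.applySub u = b.applySub u := by
      intro a ha b hb hab
      refine FOAtom.applySub_eq_of_imp hab fun s hs t ht hst => hu.1 s t (Or.inr ⟨?_, ?_, hst⟩)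
      · exact Finset.mem_union_left _ (mem_termsFS.2 ⟨a, ha, hs⟩)
      · exact Finset.mem_union_right _ (mem_termsFS.2 ⟨b, hb, ht⟩)
    apply Finset.Subset.antisymm
    · intro x hx
      obtain ⟨a, ha, rfl⟩ := Finset.mem_image.1 hx
      obtain ⟨haQ, haF⟩ := Finset.mem_filter.1 ha
      rcases Finset.mem_union.1 (hQ a haQ) with h | h
      · exact absurd h haF
      obtain ⟨b, hb, hba⟩ := Finset.mem_image.1 h
      have hb' : b ∈ headPiece F Q H φ :=
        Finset.mem_filter.2 ⟨hb, Finset.mem_image.2 ⟨a, ha, hba.symm⟩⟩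
      exact Finset.mem_image.2 ⟨b, hb', (key a ha b hb' hba.symm).symm⟩
    · intro x hx
      obtain ⟨b, hb, rfl⟩ := Finset.mem_image.1 hx
      obtain ⟨a, ha, hab⟩ := Finset.mem_image.1 (Finset.mem_filter.1 hb).2
      exact Finset.mem_image.2 ⟨a, ha, key a ha b hb hab⟩

end PieceOfHom

/-- Countably many disjoint copies of an infinite type embed into it, avoiding a finite set. -/
lemma exists_injective_prod_avoiding {V : Type} [Infinite V] (S : Finset V) :
    ∃ e : V × ℕ → V, Function.Injective e ∧ ∀ x, e x ∉ S := by
  have hcard : Cardinal.mk (V × ℕ) = Cardinal.mk ((S : Set V)ᶜ : Set V) := by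
    rw [Cardinal.mk_compl_of_infinite]
    · simp
    · exact (Cardinal.lt_aleph0_of_finite _).trans_le (Cardinal.aleph0_le_mk V)
  obtain ⟨f⟩ := Cardinal.eq.1 hcard
  exact ⟨fun x => f x, Subtype.val_injective.comp f.injective, fun x => (f x).2⟩

/-- let `ℱ₁ = (ℱ ∖ {F}) ∪ α_∨(F, R, h)` for a trigger `(R, h)` on
`F ∈ ℱ`. If `ℱ₁ ⊨ 𝒬` then either `ℱ ⊨ 𝒬` or there is a disjunctive piece-unifier
`μ_∨` of `𝒬` with `R` such that `ℱ ⊨ {β_∨(𝒬, R, μ_∨)} ∪ 𝒬`. -/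
theorem stmt7 {P V C : Type} [DecidableEq P] [DecidableEq V] [DecidableEq C] [Infinite V]
    (ℱ : Finset (Finset (FOAtom P V C))) (F : Finset (FOAtom P V C)) (hF : F ∈ ℱ)
    (𝒬 : Finset (Finset (FOAtom P V C)))
    (R : DisjRule P V C) (hWF : R.WF)
    (h : FOSubst V C) (htrig : IsTrigger R h F)
    (L : List (Finset (FOAtom P V C))) (hα : IsAlpha F R h L)
    (hent : ∀ G ∈ (ℱ.erase F) ∪ L.toFinset, ∃ Q ∈ 𝒬, EntailsFS G Q) :
    (∀ G ∈ ℱ, ∃ Q ∈ 𝒬, EntailsFS G Q) ∨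
    (∃ μ : DisjPieceUnif P V C,
       IsDisjPieceUnifier (↑𝒬 : Set (Finset (FOAtom P V C))) R μ ∧
       ∃ u : FOSubst V C, IsAssocSub μ.rel u ∧
         ∀ G ∈ ℱ, ∃ Q ∈ insert (betaRw R μ u) 𝒬, EntailsFS G Q) := by
  by_cases hFQ : ∃ Q ∈ 𝒬, EntailsFS F Q
  · left
    intro G hG
    by_cases hGF : G = F
    · exact hGF ▸ hFQ
    · exact hent G (Finset.mem_union_left _ (Finset.mem_erase.2 ⟨hGF, hG⟩))
  right
  have hex : ∀ i : Fin R.heads.length, ∃ (h' : FOSubst V C) (Q : Finset (FOAtom P V C))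
      (k : FOSubst V C), IsSafeExt F R (R.heads.get i) h h' ∧ Q ∈ 𝒬 ∧
        IsHom k Q (F ∪ applySubFS h' (R.heads.get i)) := by
    intro i
    have hi : (i : ℕ) < L.length := i.2.trans_eq hα.1.symm
    obtain ⟨h', hsafe, hL⟩ := hα.2 i hi i.2
    obtain ⟨Q, hQ, k, hk⟩ := hent (L.get ⟨i, hi⟩)
      (Finset.mem_union_right _ (List.mem_toFinset.2 (List.get_mem _ _)))
    rw [hL] at hk
    exact ⟨h', Q, k, hsafe, hQ, hk⟩
  choose h' Q k hsafe hQ hk using hex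
  obtain ⟨e, he, heR⟩ := exists_injective_prod_avoiding R.vars
  let n := R.heads.length
  -- `φ i` maps the `i`-th copy by `k i` and the variables of the rule by `h' i`
  have hφ : ∃ φ : Fin n → FOSubst V C,
      (∀ i j x, φ i (e (x, (j : Fin n))) = k j x) ∧ ∀ i, ∀ v ∈ R.vars, φ i v = h' i v := by
    classical
    refine ⟨fun i v => if hv : ∃ x : V × Fin n, e (x.1, x.2) = v
      then k hv.choose.2 hv.choose.1 else h' i v, ?_, ?_⟩
    · intro i j x
      have hv : ∃ y : V × Fin n, e (y.1, y.2) = e (x, (j : Fin n)) := ⟨(x, j), rfl⟩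
      have hc := he hv.choose_spec
      simp only [Prod.mk.injEq] at hc
      simp only [dif_pos hv]
      rw [hc.1, Fin.ext hc.2]
    · intro i v hv
      have hv' : ¬ ∃ x : V × Fin n, e (x.1, x.2) = v := by
        rintro ⟨x, rfl⟩
        exact heR _ hv
      simp only [dif_neg hv']
  obtain ⟨φ, hφe, hφR⟩ := hφ
  have hφB : ∀ i, ∀ v ∈ varsFS R.body, φ i v = h v := fun i v hv => by
    rw [hφR i v (varsFS_body_subset R hv)]
    exact (hsafe i).1 v (by simp [hv])
  have hφH : ∀ i, ∀ v ∈ varsFS (R.heads.get i), φ i v = h' i v := fun i v hv =>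
    hφR i v (varsFS_head_subset R (List.get_mem _ _) hv)
  -- collapsing the variables outside `F` makes the `φ i` agree on the variables of the rule
  obtain ⟨d⟩ : Nonempty V := inferInstance
  let κ : FOSubst V C := fun v => if v ∈ varsFS F then FOTerm.var v else FOTerm.var d
  have hκ : ∀ t : FOTerm V C, (∀ w, t = FOTerm.var w → w ∈ varsFS F) → t.applySub κ = t := by
    intro t ht
    cases t with
    | var w => exact if_pos (ht w rfl)
    | const c => rfl
  have hκF : ∀ a ∈ F, a.applySub κ = a := by
    intro a ha
    have hid : a.applySub κ = a.applySub FOTerm.var :=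
      FOAtom.applySub_congr_var fun v hv => if_pos (mem_varsFS.2 ⟨a, ha, hv⟩)
    have hvar : FOTerm.applySub (FOTerm.var : FOSubst V C) = id := by
      funext t
      cases t <;> rfl
    rw [hid]
    simp [FOAtom.applySub, hvar]
  have hhB : ∀ v ∈ varsFS R.body, (h v).applySub κ = h v := fun v hv =>
    hκ _ fun w hw => IsHom.mem_varsFS htrig hv hw
  have hψ : ∃ ψ : FOSubst V C, (∀ (j : Fin n) x, ψ (e (x, j)) = (k j x).applySub κ) ∧
      (∀ v ∈ varsFS R.body, ψ v = h v) ∧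
      ∀ v ∈ R.vars, v ∉ varsFS R.body → ψ v = FOTerm.var d := by
    obtain ⟨i₀⟩ : Nonempty (Fin n) := ⟨⟨0, List.length_pos_iff.2 hWF.2.1⟩⟩
    refine ⟨fun v => if v ∈ R.vars then if v ∈ varsFS R.body then h v else FOTerm.var d
      else (φ i₀ v).applySub κ, ?_, ?_, ?_⟩
    · intro j x
      simp only [if_neg (heR (x, (j : ℕ))), hφe]
    · intro v hv
      simp only [if_pos (varsFS_body_subset R hv), if_pos hv]
    · intro v hv hvB
      simp only [if_pos hv, if_neg hvB]
  obtain ⟨ψ, hψe, hψB, hψd⟩ := hψ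
  let Qc : Fin n → Finset (FOAtom P V C) := fun i =>
    (Q i).image (FOAtom.applySub (fun v => FOTerm.var (e (v, i))))
  have hQc : ∀ i, ∀ v ∈ varsFS (Qc i), ∃ x, v = e (x, (i : ℕ)) := by
    intro i v hv
    obtain ⟨a, ha, hva⟩ := mem_varsFS.1 hv
    obtain ⟨b, -, rfl⟩ := Finset.mem_image.1 ha
    obtain ⟨t, -, ht⟩ := List.mem_map.1 hva
    cases t with
    | var x => exact ⟨x, (FOTerm.var.inj ht).symm⟩
    | const c => exact absurd ht (by simp [FOTerm.applySub])
  have hφQ : ∀ i, IsHom (φ i) (Qc i) (F ∪ applySubFS (φ i) (R.heads.get i)) := by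
    intro i a ha
    obtain ⟨b, hb, rfl⟩ := Finset.mem_image.1 ha
    have hcopy : (b.applySub fun v => FOTerm.var (e (v, i))).applySub (φ i)
        = b.applySub (k i) := by
      rw [FOAtom.applySub_applySub]
      exact FOAtom.applySub_congr_var fun v _ => hφe i i v
    have himg : applySubFS (φ i) (R.heads.get i) = applySubFS (h' i) (R.heads.get i) :=
      Finset.image_congr fun c hc => FOAtom.applySub_congr_var fun v hv =>
        hφH i v (mem_varsFS.2 ⟨c, hc, hv⟩)
    rw [hcopy, himg]
    exact hk i b hb
  have hφbody : ∀ i, IsHom (φ i) R.body F := by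
    intro i a ha
    rw [FOAtom.applySub_congr_var (w := h) fun v hv => hφB i v (mem_varsFS.2 ⟨a, ha, hv⟩)]
    exact htrig a ha
  have hpiece : ∀ i, IsPieceUnifier (Qc i) R.body (R.heads.get i)
      (pieceOfHom F (Qc i) (R.heads.get i) (φ i)) := by
    intro i
    refine isPieceUnifier_pieceOfHom (hφbody i) (hφQ i) ?_ ?_ ?_
    · intro hom
      refine hFQ ⟨Q i, hQ i, fun v => φ i (e (v, i)), fun a ha => ?_⟩
      have := hom _ (Finset.mem_image_of_mem _ ha)
      rwa [FOAtom.applySub_applySub] at this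
    · intro z hz
      rw [hφH i z (Finset.mem_sdiff.1 hz).1]
      exact (hsafe i).2.1 z hz
    · intro z hz z' hz' hzz
      rw [hφH i z (Finset.mem_sdiff.1 hz).1, hφH i z' (Finset.mem_sdiff.1 hz').1] at hzz
      exact (hsafe i).2.2 z hz z' hz' hzz
  have hψQ : ∀ i, ∀ v ∈ varsFS (Qc i), ψ v = (φ i v).applySub κ := by
    intro i v hv
    obtain ⟨x, rfl⟩ := hQc i v hv
    rw [hψe, hφe]
  have hψH : ∀ i, ∀ v ∈ varsFS (R.heads.get i), ψ v = (φ i v).applySub κ := by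
    intro i v hv
    by_cases hvB : v ∈ varsFS R.body
    · rw [hψB v hvB, hφB i v hvB, hhB v hvB]
    · obtain ⟨w, hw, hwF⟩ := (hsafe i).2.1 v (Finset.mem_sdiff.2 ⟨hv, hvB⟩)
      rw [hφH i v hv, hw, hψd v (varsFS_head_subset R (List.get_mem _ _) hv) hvB]
      exact (if_neg hwF).symm
  have hψrel : ∀ i s t, (pieceOfHom F (Qc i) (R.heads.get i) (φ i)).rel s t →
      s.applySub ψ = t.applySub ψ := by
    intro i s t hst
    rcases hst with rfl | ⟨hs, ht, hst⟩
    · rfl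
    have hfactor : ∀ t ∈ termsFS (queryPiece F (Qc i) (φ i)) ∪
        termsFS (headPiece F (Qc i) (R.heads.get i) (φ i)),
        t.applySub ψ = (t.applySub (φ i)).applySub κ := by
      intro t ht
      cases t with
      | const c => rfl
      | var v =>
        rcases Finset.mem_union.1 ht with ht | ht
        · obtain ⟨a, ha, hva⟩ := mem_termsFS.1 ht
          exact hψQ i v (mem_varsFS.2 ⟨a, Finset.filter_subset _ _ ha, hva⟩)
        · obtain ⟨a, ha, hva⟩ := mem_termsFS.1 ht
          exact hψH i v (mem_varsFS.2 ⟨a, Finset.filter_subset _ _ ha, hva⟩)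
    rw [hfactor s hs, hfactor t ht, hst]
  let μ : DisjPieceUnif P V C :=
    ⟨List.ofFn Qc, List.ofFn fun i => pieceOfHom F (Qc i) (R.heads.get i) (φ i)⟩
  have hψjoin : ∀ s t, μ.rel s t → s.applySub ψ = t.applySub ψ := by
    intro s t hst
    refine joinRel_applySub ?_ hst
    intro r hr s t hrst
    obtain ⟨m, hm, rfl⟩ := List.mem_map.1 hr
    obtain ⟨i, rfl⟩ := (List.mem_ofFn' _ _).1 hm
    exact hψrel i s t hrst
  have hadm : RelAdmissible μ.rel := fun c c' hcc => by
    simpa [FOTerm.applySub] using hψjoin _ _ hcc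
  obtain ⟨u, hu⟩ := exists_isAssocSub (Relation.EqvGen.is_equivalence _) hadm
  have hdisj : ∀ i, Disjoint (varsFS (Qc i)) R.vars := by
    intro i
    rw [Finset.disjoint_left]
    intro v hv
    obtain ⟨x, rfl⟩ := hQc i v hv
    exact heR _
  have hdisj' : ∀ i j, i ≠ j → Disjoint (varsFS (Qc i)) (varsFS (Qc j)) := by
    intro i j hij
    rw [Finset.disjoint_left]
    intro v hv hv'
    obtain ⟨x, rfl⟩ := hQc i v hv
    obtain ⟨y, hxy⟩ := hQc j _ hv'
    exact hij (Fin.ext (Prod.mk.inj (he hxy)).2)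
  refine ⟨μ, ⟨by simp [μ, n], by simp [μ, n], ?_, ?_, ?_, ?_, hadm⟩, u, hu, ?_⟩
  · intro i hi
    have hi' : i < n := by simpa [μ] using hi
    refine ⟨Q ⟨i, hi'⟩, hQ _, fun v => e (v, i), fun x y hxy => (Prod.mk.inj (he hxy)).1, ?_⟩
    simp [μ, Qc]
  · intro i hi
    have hi' : i < n := by simpa [μ] using hi
    simpa [μ] using hdisj ⟨i, hi'⟩
  · intro i j hi hj hij
    have hi' : i < n := by simpa [μ] using hi
    have hj' : j < n := by simpa [μ] using hj
    simpa [μ] using hdisj' ⟨i, hi'⟩ ⟨j, hj'⟩ (by simpa using hij)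
  · intro i hi _ _
    simpa [μ] using hpiece ⟨i, hi⟩
  intro G hG
  by_cases hGF : G = F
  · subst hGF
    refine ⟨_, Finset.mem_insert_self _ _, ψ, ?_⟩
    have hψu : ∀ a : FOAtom P V C, (a.applySub u).applySub ψ = a.applySub ψ := by
      intro a
      rw [FOAtom.applySub_applySub]
      exact FOAtom.applySub_congr_var fun v _ => (hψjoin _ _ (hu.2.1 (FOTerm.var v))).symm
    intro x hx
    rcases Finset.mem_union.1 hx with hx | hx
    · obtain ⟨a, ha, rfl⟩ := Finset.mem_image.1 hx
      rw [hψu, FOAtom.applySub_congr_var (w := h) fun v hv => hψB v (mem_varsFS.2 ⟨a, ha, hv⟩)]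
      exact htrig a ha
    · obtain ⟨s, hs, hxs⟩ := mem_foldr_union.1 hx
      obtain ⟨i, hi, rfl⟩ := List.mem_iff_getElem.1 hs
      have hi' : i < n := by simpa [μ] using hi
      simp only [μ, List.getElem_zipWith, List.getElem_ofFn] at hxs
      obtain ⟨a, ha, rfl⟩ := Finset.mem_image.1 hxs
      obtain ⟨haQ, haQ'⟩ := Finset.mem_sdiff.1 ha
      have haF : a.applySub (φ ⟨i, hi'⟩) ∈ G := by
        by_contra haF
        exact haQ' (Finset.mem_filter.2 ⟨haQ, haF⟩)
      have hψa : a.applySub ψ = (a.applySub (φ ⟨i, hi'⟩)).applySub κ := by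
        rw [FOAtom.applySub_applySub]
        exact FOAtom.applySub_congr_var fun v hv => hψQ _ v (mem_varsFS.2 ⟨a, haQ, hv⟩)
      rw [hψu, hψa, hκF _ haF]
      exact haF
  · obtain ⟨Q₀, hQ₀, hGQ⟩ := hent G (Finset.mem_union_left _ (Finset.mem_erase.2 ⟨hGF, hG⟩))
    exact ⟨Q₀, Finset.mem_insert_of_mem hQ₀, hGQ⟩
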